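/- Let ξ ∈ h*/ℤR have nonzero central charge and assume λ(h) ∈ ℤ for every λ ∈ ξ. Then the Verma module Δ(λ) is simple for every λ ∈ ξ, and for each i ∈ ℤ≥0 the Serre subcategory O[ξ]_{λ_i} of O[ξ] generated by Δ(λ_i) and Δ(r·λ_i) (where λ_i ∈ ξ has λ_i(h) = -1 + i, (r·λ_i)(h) = -λ_i(h) - 3, (r·λ_i)(z) = λ_i(z)) is equivalent to the category of finite dimensional modules over ℂ ⊕ ℂ, i.e. it is semisimple with exactly two isomorphism classes of simple objects; moreover O[ξ] is the direct sum of these subcategories O[ξ]_{λ_i}, i ∈ ℤ≥0. -/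

import Mathlib

namespace Schrodinger

noncomputable section

open scoped TensorProduct

/-- Generators of the Schrödinger algebra. -/
inductive Gen : Type
  | E | H | F | P | Q | Z
  deriving DecidableEq

/-- The free algebra on the generators. -/
abbrev FA : Type := FreeAlgebra ℂ Gen

/-- Inclusion of generators. -/
def ιg (g : Gen) : FA := FreeAlgebra.ι ℂ g

/-- The defining relations of the universal enveloping algebra of the Schrödinger
algebra `s`: `z` is central and `[h,e]=2e`, `[e,f]=h`, `[h,f]=-2f`, `[e,q]=p`,
`[e,p]=0`, `[h,p]=p`, `[f,p]=q`, `[f,q]=0`, `[h,q]=-q`, `[p,q]=z`. -/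
inductive Rel : FA → FA → Prop
  | he : Rel (ιg .H * ιg .E) (ιg .E * ιg .H + 2 * ιg .E)
  | ef : Rel (ιg .E * ιg .F) (ιg .F * ιg .E + ιg .H)
  | hf : Rel (ιg .H * ιg .F) (ιg .F * ιg .H - 2 * ιg .F)
  | eq : Rel (ιg .E * ιg .Q) (ιg .Q * ιg .E + ιg .P)
  | ep : Rel (ιg .E * ιg .P) (ιg .P * ιg .E)
  | hp : Rel (ιg .H * ιg .P) (ιg .P * ιg .H + ιg .P)
  | fp : Rel (ιg .F * ιg .P) (ιg .P * ιg .F + ιg .Q)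
  | fq : Rel (ιg .F * ιg .Q) (ιg .Q * ιg .F)
  | hq : Rel (ιg .H * ιg .Q) (ιg .Q * ιg .H - ιg .Q)
  | pq : Rel (ιg .P * ιg .Q) (ιg .Q * ιg .P + ιg .Z)
  | ze : Rel (ιg .Z * ιg .E) (ιg .E * ιg .Z)
  | zh : Rel (ιg .Z * ιg .H) (ιg .H * ιg .Z)
  | zf : Rel (ιg .Z * ιg .F) (ιg .F * ιg .Z)
  | zp : Rel (ιg .Z * ιg .P) (ιg .P * ιg .Z)
  | zq : Rel (ιg .Z * ιg .Q) (ιg .Q * ιg .Z)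

/-- The universal enveloping algebra `U = U(s)` of the Schrödinger algebra,
presented by generators and relations (via the PBW theorem). -/
abbrev U : Type := RingQuot Rel

/-- The generators of `U`. -/
def gen (g : Gen) : U := RingQuot.mkAlgHom ℂ Rel (ιg g)

def E : U := gen .E
def H : U := gen .H
def F : U := gen .F
def P : U := gen .P
def Q : U := gen .Q
def Z : U := gen .Z

/-- Scalars inside `U`. -/
def sc (a : ℂ) : U := algebraMap ℂ U a

/-- The Casimir element `c = (h² + h + 4fe)z − 2(fp² − eq² − hpq)`. -/
def cElt : U := (H * H + H + 4 * (F * E)) * Z - 2 * (F * (P * P) - E * (Q * Q) - H * (P * Q))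

/-- The left ideal of `U` defining the Verma module `Δ(λ)` for
`λ ∈ 𝔥*` with `λ(h) = hh`, `λ(z) = zz`:  it is generated by `n₊ = span{e,p}`
together with `h - λ(h)` and `z - λ(z)`; then
`Δ(λ) = U ⊗_{U(𝔟)} ℂ_λ ≅ U / U(e, p, h - λ(h), z - λ(z))`. -/
def vermaIdeal (hh zz : ℂ) : Submodule U U :=
  Submodule.span U ({E, P, H - sc hh, Z - sc zz} : Set U)

/-- The Verma module `Δ(λ)` with highest weight `λ`, `λ(h) = hh`, `λ(z) = zz`. -/
abbrev Verma (hh zz : ℂ) : Type := U ⧸ vermaIdeal hh zz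

/-- The canonical highest weight generator `v_λ` of `Δ(λ)`. -/
def hwVec (hh zz : ℂ) : Verma hh zz := Submodule.Quotient.mk 1

/-- The unique maximal submodule `K(λ)` of `Δ(λ)`. -/
def vermaRad (hh zz : ℂ) : Submodule U (Verma hh zz) := sSup {N : Submodule U (Verma hh zz) | N ≠ ⊤}

/-- The simple highest weight module `L(λ) = Δ(λ)/K(λ)`. -/
abbrev SimpleHW (hh zz : ℂ) : Type := Verma hh zz ⧸ vermaRad hh zz

/-- The scalar `ϑ_λ = (λ(h)² + 3λ(h) + 2)·λ(z)` by which the Casimir element `c`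
acts on the Verma module `Δ(λ)`. -/
def vartheta (hh zz : ℂ) : ℂ := (hh ^ 2 + 3 * hh + 2) * zz

end

end Schrodinger

namespace Schrodinger

noncomputable section

open CategoryTheory

/-- The `ℂ`-vector space structure on a `U`-module, obtained by restricting
scalars along `ℂ → U`. -/
def cmod (M : Type) [AddCommGroup M] [Module U M] : Module ℂ M :=
  Module.compHom M (algebraMap ℂ U)

/-- `v` is a weight vector of weight `λ` with `λ(h) = hh` and `λ(z) = zz`. -/
def IsWeightVec {M : Type} [AddCommGroup M] [Module U M] (hh zz : ℂ) (v : M) : Prop :=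
  H • v = sc hh • v ∧ Z • v = sc zz • v

/-- The subalgebra `U(n₊)` of `U` generated by `n₊ = span{e, p}`. -/
def nPlus : Subalgebra ℂ U := Algebra.adjoin ℂ ({E, P} : Set U)

/-- Membership in category `O`: finitely generated, a (direct) sum of its
weight spaces, and locally `U(n₊)`-finite. -/
def InO (M : Type) [AddCommGroup M] [Module U M] : Prop :=
  Module.Finite U M ∧
  (∀ v : M, v ∈ AddSubgroup.closure {w : M | ∃ hh zz : ℂ, IsWeightVec hh zz w}) ∧
  (letI := cmod M
   ∀ v : M, ∃ W : Submodule ℂ M, FiniteDimensional ℂ W ∧ ∀ u ∈ nPlus, u • v ∈ W)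

/-- Membership in the block `O[ξ]`, where `ξ ∈ 𝔥*/ℤR` is the class of the weight
`(hh0, zz0)` (so that the weights in `ξ` are exactly `(hh0 + n, zz0)`, `n ∈ ℤ`):
the module is in `O` and all its weights lie in `ξ`. -/
def InBlock (hh0 zz0 : ℂ) (M : ModuleCat.{0} U) : Prop :=
  InO M ∧
  ∀ (v : M) (hh zz : ℂ), v ≠ 0 → IsWeightVec hh zz v → zz = zz0 ∧ ∃ n : ℤ, hh = hh0 + n

/-- The Verma module as an object of the category of `U`-modules. -/
def VermaC (hh zz : ℂ) : ModuleCat.{0} U := ModuleCat.of U (Verma hh zz)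

/-- `Pc` is a Serre class inside the subcategory (of the category of `U`-modules)
cut out by `Oc`: it is contained in `Oc`, closed under isomorphism, and for every
short exact sequence `0 → N → M → M/N → 0` in `Oc`, `M` belongs to `Pc` if and only
if both `N` and `M/N` do. -/
def SerreClassIn (Oc Pc : ModuleCat.{0} U → Prop) : Prop :=
  (∀ M, Pc M → Oc M) ∧
  (∀ M N : ModuleCat.{0} U, Nonempty ((M : Type) ≃ₗ[U] (N : Type)) → Pc M → Oc N → Pc N) ∧
  (∀ (M : ModuleCat.{0} U) (N : Submodule U M), Oc M →
      (Pc M ↔ Pc (ModuleCat.of U N) ∧ Pc (ModuleCat.of U ((M : Type) ⧸ N))))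

/-- Membership in the Serre subcategory of the subcategory cut out by `Oc`
generated by the set of objects `S`. -/
def InSerreGen (Oc : ModuleCat.{0} U → Prop) (S : Set (ModuleCat.{0} U))
    (M : ModuleCat.{0} U) : Prop :=
  Oc M ∧ ∀ Pc : ModuleCat.{0} U → Prop, SerreClassIn Oc Pc → (∀ X ∈ S, Pc X) → Pc M

end

end Schrodinger

namespace Schrodinger

open CategoryTheory

noncomputable section

/-- The Serre subcategory `O[ξ]_{λ_i}` of the integral block `O[ξ]` of central
charge `zz` generated by `Δ(λ_i)` and `Δ(r·λ_i)`, where `λ_i(h) = -1 + i` and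
`(r·λ_i)(h) = -λ_i(h) - 3 = -2 - i`. -/
def intBlockSub (zz : ℂ) (i : ℕ) : ModuleCat.{0} U → Prop :=
  InSerreGen (InBlock 0 zz)
    {VermaC (-1 + (i : ℂ)) zz, VermaC (-2 - (i : ℂ)) zz}

/-- Two elements of the free algebra identified by the defining relations agree in `U`. -/
lemma mk_eq_of_rel {a b : FA} (h : Rel a b) :
    RingQuot.mkAlgHom ℂ Rel a = RingQuot.mkAlgHom ℂ Rel b :=
  RingQuot.mkAlgHom_rel ℂ h

/-- Induction principle for `U`: scalars, generators, products and sums. -/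
lemma U_induction {p : U → Prop} (scalar : ∀ a, p (sc a)) (gens : ∀ g, p (gen g))
    (mul : ∀ a b, p a → p b → p (a * b)) (add : ∀ a b, p a → p b → p (a + b)) (u : U) : p u := by
  obtain ⟨a, rfl⟩ := RingQuot.mkAlgHom_surjective ℂ Rel u
  induction a using FreeAlgebra.induction with
  | grade0 r => simpa [sc] using scalar r
  | grade1 g => exact gens g
  | mul a b ha hb => rw [map_mul]; exact mul _ _ ha hb
  | add a b ha hb => rw [map_add]; exact add _ _ ha hb

section Relations

variable {M : Type} [AddCommGroup M] [Module U M]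

lemma E_F (x : M) : E • F • x = F • E • x + H • x := by
  have h : E * F = F * E + H := by simpa [E, F, H, gen] using mk_eq_of_rel .ef
  rw [← mul_smul, h, add_smul, mul_smul]

lemma E_Q (x : M) : E • Q • x = Q • E • x + P • x := by
  have h : E * Q = Q * E + P := by simpa [E, Q, P, gen] using mk_eq_of_rel .eq
  rw [← mul_smul, h, add_smul, mul_smul]

lemma E_P (x : M) : E • P • x = P • E • x := by
  have h : E * P = P * E := by simpa [E, P, gen] using mk_eq_of_rel .ep
  rw [← mul_smul, h, mul_smul]

lemma F_P (x : M) : F • P • x = P • F • x + Q • x := by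
  have h : F * P = P * F + Q := by simpa [F, P, Q, gen] using mk_eq_of_rel .fp
  rw [← mul_smul, h, add_smul, mul_smul]

lemma F_Q (x : M) : F • Q • x = Q • F • x := by
  have h : F * Q = Q * F := by simpa [F, Q, gen] using mk_eq_of_rel .fq
  rw [← mul_smul, h, mul_smul]

lemma H_P (x : M) : H • P • x = P • H • x + P • x := by
  have h : H * P = P * H + P := by simpa [H, P, gen] using mk_eq_of_rel .hp
  rw [← mul_smul, h, add_smul, mul_smul]

lemma H_Q (x : M) : H • Q • x = Q • H • x - Q • x := by
  have h : H * Q = Q * H - Q := by simpa [H, Q, gen] using mk_eq_of_rel .hq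
  rw [← mul_smul, h, sub_smul, mul_smul]

lemma P_Q (x : M) : P • Q • x = Q • P • x + Z • x := by
  have h : P * Q = Q * P + Z := by simpa [P, Q, Z, gen] using mk_eq_of_rel .pq
  rw [← mul_smul, h, add_smul, mul_smul]

lemma gen_Z (g : Gen) (x : M) : gen g • Z • x = Z • gen g • x := by
  have h : gen g * Z = Z * gen g := by
    cases g
    · simpa [Z, gen] using (mk_eq_of_rel .ze).symm
    · simpa [Z, gen] using (mk_eq_of_rel .zh).symm
    · simpa [Z, gen] using (mk_eq_of_rel .zf).symm
    · simpa [Z, gen] using (mk_eq_of_rel .zp).symm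
    · simpa [Z, gen] using (mk_eq_of_rel .zq).symm
    · rfl
  rw [← mul_smul, h, mul_smul]

variable [Module ℂ M]

lemma H_E (x : M) : H • E • x = E • H • x + (2 : ℂ) • E • x := by
  have h : H * E = E * H + (E + E) := by simpa [H, E, gen, two_mul] using mk_eq_of_rel .he
  rw [← mul_smul, h, add_smul, mul_smul, add_smul, two_smul]

lemma H_F (x : M) : H • F • x = F • H • x - (2 : ℂ) • F • x := by
  have h : H * F = F * H - (F + F) := by simpa [H, F, gen, two_mul] using mk_eq_of_rel .hf
  rw [← mul_smul, h, sub_smul, mul_smul, add_smul, two_smul]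

variable [IsScalarTower ℂ U M]

lemma sc_smul (a : ℂ) (x : M) : sc a • x = a • x :=
  algebraMap_smul U a x

lemma smul_scalar (u : U) (a : ℂ) (x : M) : u • a • x = a • u • x := smul_comm u a x

lemma cElt_smul (x : M) : cElt • x = H • H • Z • x + H • Z • x + (4 : ℂ) • F • E • Z • x
    - (2 : ℂ) • (F • P • P • x - E • Q • Q • x - H • P • Q • x) := by
  have h4 : (4 : U) = sc 4 := (map_ofNat (algebraMap ℂ U) 4).symm
  have h2 : (2 : U) = sc 2 := (map_ofNat (algebraMap ℂ U) 2).symm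
  simp only [cElt, sub_smul, add_smul, mul_smul, h4, h2, sc_smul, smul_sub]

/-- The Casimir element is central. -/
lemma cElt_central (u : U) (x : M) : cElt • u • x = u • cElt • x := by
  induction u using U_induction generalizing x with
  | scalar a => rw [sc_smul, sc_smul, smul_scalar]
  | mul a b ha hb => rw [mul_smul, ha, hb, mul_smul]
  | add a b ha hb => rw [add_smul, smul_add, ha, hb, add_smul]
  | gens g =>
    have hEH : ∀ x : M, E • H • x = H • E • x - (2 : ℂ) • E • x := fun x => by
      rw [H_E, add_sub_cancel_right]
    have hPH : ∀ x : M, P • H • x = H • P • x - P • x := fun x => by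
      rw [H_P, add_sub_cancel_right]
    have hPF : ∀ x : M, P • F • x = F • P • x - Q • x := fun x => by
      rw [F_P, add_sub_cancel_right]
    have hQF : ∀ x : M, Q • F • x = F • Q • x := fun x => (F_Q x).symm
    have hQZ : ∀ x : M, Q • Z • x = Z • Q • x := gen_Z .Q
    have hPZ : ∀ x : M, P • Z • x = Z • P • x := gen_Z .P
    have hEZ : ∀ x : M, E • Z • x = Z • E • x := gen_Z .E
    have hFZ : ∀ x : M, F • Z • x = Z • F • x := gen_Z .F
    have hHZ : ∀ x : M, H • Z • x = Z • H • x := gen_Z .H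
    have h4 : ∀ x : M, (4 : ℂ) • x = x + x + (x + x) := fun x => by module
    rw [cElt_smul, cElt_smul]
    cases g <;> simp only [show gen .E = E from rfl, show gen .F = F from rfl,
      show gen .H = H from rfl, show gen .P = P from rfl, show gen .Q = Q from rfl,
      show gen .Z = Z from rfl, smul_add, smul_sub, hEH, hPH, hPF, hQF, hQZ, hPZ,
      hEZ, hFZ, hHZ, E_F, E_Q, E_P, H_F, H_Q, P_Q, two_smul ℂ, h4] <;> abel

end Relations

section Fock

/-- The action of the generators on formal series `∑ g a b · f'^a q^b v`, where `v` is a highest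
weight vector of weight `n`, and `f' = f + q² / (2z)` commutes with `p` and `q`. -/
def fockOp (n zz : ℂ) : Gen → Module.End ℂ (ℕ → ℕ → ℂ)
  | .E =>
    { toFun := fun g a b => (a + 1) * (n + 1 / 2 - a) * g (a + 1) b
        + zz * ((b + 2) * (b + 1) / 2) * g a (b + 2)
      map_add' := fun g g' => by ext a b; simp only [Pi.add_apply]; ring
      map_smul' := fun c g => by
        ext a b; simp only [Pi.smul_apply, smul_eq_mul, RingHom.id_apply]; ring }
  | .H =>
    { toFun := fun g a b => (n - 2 * a - b) * g a b
      map_add' := fun g g' => by ext a b; simp only [Pi.add_apply]; ring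
      map_smul' := fun c g => by
        ext a b; simp only [Pi.smul_apply, smul_eq_mul, RingHom.id_apply]; ring }
  | .F =>
    { toFun := fun g a b => (if a = 0 then 0 else g (a - 1) b)
        - (2 * zz)⁻¹ * (if b ≤ 1 then 0 else g a (b - 2))
      map_add' := fun g g' => by
        ext a b; simp only [Pi.add_apply]; split_ifs <;> ring
      map_smul' := fun c g => by
        ext a b; simp only [Pi.smul_apply, smul_eq_mul, RingHom.id_apply]; split_ifs <;> ring }
  | .P =>
    { toFun := fun g a b => zz * (b + 1) * g a (b + 1)
      map_add' := fun g g' => by ext a b; simp only [Pi.add_apply]; ring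
      map_smul' := fun c g => by
        ext a b; simp only [Pi.smul_apply, smul_eq_mul, RingHom.id_apply]; ring }
  | .Q =>
    { toFun := fun g a b => if b = 0 then 0 else g a (b - 1)
      map_add' := fun g g' => by ext a b; simp only [Pi.add_apply]; split_ifs <;> ring
      map_smul' := fun c g => by
        ext a b; simp only [Pi.smul_apply, smul_eq_mul, RingHom.id_apply]; split_ifs <;> ring }
  | .Z => zz • LinearMap.id

variable (n zz : ℂ) (g : ℕ → ℕ → ℂ) (a b : ℕ)

lemma fockOp_E : fockOp n zz .E g a b = (a + 1) * (n + 1 / 2 - a) * g (a + 1) b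
    + zz * ((b + 2) * (b + 1) / 2) * g a (b + 2) := rfl

lemma fockOp_H : fockOp n zz .H g a b = (n - 2 * a - b) * g a b := rfl

lemma fockOp_F : fockOp n zz .F g a b = (if a = 0 then 0 else g (a - 1) b)
    - (2 * zz)⁻¹ * (if b ≤ 1 then 0 else g a (b - 2)) := rfl

lemma fockOp_P : fockOp n zz .P g a b = zz * (b + 1) * g a (b + 1) := rfl

lemma fockOp_Q : fockOp n zz .Q g a b = if b = 0 then 0 else g a (b - 1) := rfl

lemma fockOp_Z : fockOp n zz .Z g a b = zz * g a b := rfl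

/-- The representation of `U` on formal series. -/
def fockRep (hzz : zz ≠ 0) : U →ₐ[ℂ] Module.End ℂ (ℕ → ℕ → ℂ) :=
  RingQuot.liftAlgHom ℂ ⟨FreeAlgebra.lift ℂ (fockOp n zz), by
    have h2 : FreeAlgebra.lift ℂ (fockOp n zz) 2 = 2 := map_ofNat _ 2
    intro x y hxy
    cases hxy <;>
      simp only [ιg, map_mul, map_add, map_sub, FreeAlgebra.lift_ι_apply, h2] <;>
      ext g a b <;>
      simp only [Module.End.mul_apply, LinearMap.add_apply, LinearMap.sub_apply, two_mul,
        Pi.add_apply, Pi.sub_apply, fockOp_E, fockOp_H, fockOp_F, fockOp_P, fockOp_Q, fockOp_Z] <;>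
      rcases a with _ | a <;> rcases b with _ | _ | _ | b <;>
      simp <;> field_simp <;> ring⟩

end Fock

/-- The space of formal series `∑ g a b · f'^a q^b v` as a `U`-module. -/
def Fock (_n zz : ℂ) (_hzz : zz ≠ 0) : Type := ℕ → ℕ → ℂ

namespace Fock

variable (n zz : ℂ) (hzz : zz ≠ 0)

instance : AddCommGroup (Fock n zz hzz) := inferInstanceAs (AddCommGroup (ℕ → ℕ → ℂ))

instance : Module ℂ (Fock n zz hzz) := inferInstanceAs (Module ℂ (ℕ → ℕ → ℂ))

instance : Module (Module.End ℂ (ℕ → ℕ → ℂ)) (Fock n zz hzz) :=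
  inferInstanceAs (Module (Module.End ℂ (ℕ → ℕ → ℂ)) (ℕ → ℕ → ℂ))

instance : Module U (Fock n zz hzz) := Module.compHom _ (fockRep n zz hzz).toRingHom

variable {n zz hzz}

lemma smul_def (u : U) (g : Fock n zz hzz) : u • g = fockRep n zz hzz u g := rfl

instance : IsScalarTower ℂ U (Fock n zz hzz) where
  smul_assoc c u g := by rw [smul_def, map_smul]; rfl

lemma gen_smul (i : Gen) (g : Fock n zz hzz) : gen i • g = fockOp n zz i g := by
  rw [smul_def, gen, fockRep, RingQuot.liftAlgHom_mkAlgHom_apply, ιg, FreeAlgebra.lift_ι_apply]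

variable (n zz hzz)

/-- The monomial `f'^i q^j v`. -/
def basisVec (i j : ℕ) : Fock n zz hzz := fun a b => if a = i ∧ b = j then 1 else 0

end Fock

section HighestWeight

variable {M : Type} [AddCommGroup M] [Module U M]

/-- `v` is a singular vector of weight `(hh, zz)`: a weight vector killed by `n₊`. -/
def IsSingular (hh zz : ℂ) (v : M) : Prop := IsWeightVec hh zz v ∧ E • v = 0 ∧ P • v = 0

/-- The element `f' = f + q² / (2z)`, for the value `zz` of `z`, which commutes with `p` and `q`
on modules of central charge `zz`. -/
def F' (zz : ℂ) : U := F + sc (2 * zz)⁻¹ * (Q * Q)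

variable [Module ℂ M] [IsScalarTower ℂ U M] {hh n zz : ℂ}

lemma isWeightVec_iff {v : M} : IsWeightVec hh zz v ↔ H • v = hh • v ∧ Z • v = zz • v := by
  rw [IsWeightVec, sc_smul, sc_smul]

lemma F'_smul (x : M) : F' zz • x = F • x + (2 * zz)⁻¹ • Q • Q • x := by
  rw [F', add_smul, mul_smul, mul_smul, sc_smul]

lemma Q_F' (x : M) : Q • F' zz • x = F' zz • Q • x := by
  rw [F'_smul, F'_smul, smul_add, F_Q, smul_scalar]

lemma Z_gen (i : Gen) {x : M} (hx : Z • x = zz • x) : Z • gen i • x = zz • gen i • x := by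
  rw [← gen_Z, hx, smul_scalar]

lemma Z_smul (u : U) {x : M} (hx : Z • x = zz • x) : Z • u • x = zz • u • x := by
  induction u using U_induction generalizing x with
  | scalar a => rw [sc_smul, smul_scalar, hx, smul_comm]
  | gens g => exact Z_gen g hx
  | mul a b ha hb => rw [mul_smul, ha (hb hx)]
  | add a b ha hb => rw [add_smul, smul_add, ha hx, hb hx, smul_add]

lemma Z_Q {x : M} (hx : Z • x = zz • x) : Z • Q • x = zz • Q • x := Z_gen .Q hx

lemma P_F' (hzz : zz ≠ 0) {x : M} (hx : Z • x = zz • x) : P • F' zz • x = F' zz • P • x := by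
  have h : P • F • x = F • P • x - Q • x := by rw [F_P, add_sub_cancel_right]
  rw [F'_smul, F'_smul, smul_add, h, smul_scalar, P_Q, P_Q, Z_Q hx, hx, smul_add, smul_add,
    smul_scalar Q]
  generalize F • P • x = y₁, Q • x = y₂, Q • Q • P • x = y₃
  match_scalars <;> field_simp
  norm_num

lemma E_F' (hzz : zz ≠ 0) {x : M} (hx : Z • x = zz • x) :
    E • F' zz • x = F' zz • E • x + H • x + (1 / 2 : ℂ) • x + zz⁻¹ • Q • P • x := by
  rw [F'_smul, F'_smul, smul_add, E_F, smul_scalar, E_Q, E_Q, P_Q, hx, smul_add, smul_add, smul_add,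
    smul_add]
  generalize F • E • x = y₁, H • x = y₂, Q • Q • E • x = y₃, Q • P • x = y₄
  match_scalars <;> field_simp
  norm_num

lemma H_F' (x : M) : H • F' zz • x = F' zz • H • x - (2 : ℂ) • F' zz • x := by
  rw [F'_smul, F'_smul, smul_add, H_F, smul_scalar, H_Q, H_Q, smul_sub, smul_sub]
  generalize F • H • x = y₁, F • x = y₂, Q • Q • H • x = y₃, Q • Q • x = y₄
  module

lemma Z_F' {x : M} (hx : Z • x = zz • x) : Z • F' zz • x = zz • F' zz • x := by
  rw [F'_smul, smul_add, show Z • F • x = _ from Z_gen .F hx, smul_scalar, Z_Q (Z_Q hx),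
    smul_add, smul_comm (2 * zz)⁻¹ zz]
  rfl

lemma IsWeightVec.Q_smul {x : M} (hx : IsWeightVec hh zz x) : IsWeightVec (hh - 1) zz (Q • x) := by
  rw [isWeightVec_iff] at *
  refine ⟨?_, Z_Q hx.2⟩
  rw [H_Q, hx.1, smul_scalar, sub_smul, one_smul]

lemma IsWeightVec.P_smul {x : M} (hx : IsWeightVec hh zz x) : IsWeightVec (hh + 1) zz (P • x) := by
  rw [isWeightVec_iff] at *
  refine ⟨?_, Z_gen .P hx.2⟩
  rw [H_P, hx.1, smul_scalar, add_smul, one_smul]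

lemma IsWeightVec.E_smul {x : M} (hx : IsWeightVec hh zz x) : IsWeightVec (hh + 2) zz (E • x) := by
  rw [isWeightVec_iff] at *
  refine ⟨?_, Z_gen .E hx.2⟩
  rw [H_E, hx.1, smul_scalar, add_smul]

lemma IsWeightVec.F'_smul {x : M} (hx : IsWeightVec hh zz x) :
    IsWeightVec (hh - 2) zz (F' zz • x) := by
  rw [isWeightVec_iff] at *
  refine ⟨?_, Z_F' hx.2⟩
  rw [H_F', hx.1, smul_scalar, sub_smul]

/-- The vector `q^b f'^a v`. -/
def monomialVec (zz : ℂ) (v : M) (a b : ℕ) : M := Q ^ b • F' zz ^ a • v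

omit [Module ℂ M] [IsScalarTower ℂ U M] in
lemma monomialVec_zero_zero (v : M) : monomialVec zz v 0 0 = v := by
  simp [monomialVec]

omit [Module ℂ M] [IsScalarTower ℂ U M] in
lemma Q_monomialVec (v : M) (a b : ℕ) :
    Q • monomialVec zz v a b = monomialVec zz v a (b + 1) := by
  rw [monomialVec, monomialVec, pow_succ', mul_smul]

lemma F'_monomialVec (v : M) (a b : ℕ) :
    F' zz • monomialVec zz v a b = monomialVec zz v (a + 1) b := by
  induction b with
  | zero => simp only [monomialVec, pow_zero, one_smul, pow_succ', mul_smul]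
  | succ b ih => rw [← Q_monomialVec, ← Q_F', ih, Q_monomialVec]

lemma IsWeightVec.monomialVec {v : M} (hv : IsWeightVec hh zz v) (a b : ℕ) :
    IsWeightVec (hh - 2 * a - b) zz (monomialVec zz v a b) := by
  induction b with
  | succ b ih =>
    rw [← Q_monomialVec]
    convert ih.Q_smul using 1
    push_cast; ring
  | zero =>
    induction a with
    | zero => simpa [monomialVec_zero_zero] using hv
    | succ a ih =>
      rw [← F'_monomialVec]
      convert ih.F'_smul using 1
      push_cast; ring

lemma IsSingular.P_monomialVec_zero (hzz : zz ≠ 0) {v : M} (hv : IsSingular hh zz v) (a : ℕ) :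
    P • monomialVec zz v a 0 = 0 := by
  induction a with
  | zero => rw [monomialVec_zero_zero, hv.2.2]
  | succ a ih =>
    rw [← F'_monomialVec, P_F' hzz (isWeightVec_iff.1 (hv.1.monomialVec a 0)).2, ih, smul_zero]

/-- The submodule generated by a singular vector `v` is spanned by the vectors `q^b f'^a v`. -/
lemma IsSingular.smul_mem_span (hzz : zz ≠ 0) {v : M} (hv : IsSingular hh zz v) (u : U) :
    u • v ∈ Submodule.span ℂ (Set.range fun i : ℕ × ℕ => Schrodinger.monomialVec zz v i.1 i.2) := by
  set S := Submodule.span ℂ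
    (Set.range fun i : ℕ × ℕ => Schrodinger.monomialVec zz v i.1 i.2) with hS
  have hmem : ∀ a b, Schrodinger.monomialVec zz v a b ∈ S :=
    fun a b => Submodule.subset_span ⟨(a, b), rfl⟩
  have hclosed : ∀ u : U, (∀ a b, u • Schrodinger.monomialVec zz v a b ∈ S) →
      ∀ x ∈ S, u • x ∈ S := by
    intro u hu x hx
    induction hx using Submodule.span_induction with
    | mem x hx => obtain ⟨i, rfl⟩ := hx; exact hu _ _
    | zero => rw [smul_zero]; exact S.zero_mem
    | add x y _ _ hx hy => rw [smul_add]; exact S.add_mem hx hy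
    | smul c x _ hx => rw [smul_scalar]; exact S.smul_mem _ hx
  have hQ : ∀ x ∈ S, Q • x ∈ S := hclosed Q fun a b => by
    rw [Q_monomialVec]; exact hmem _ _
  have hF' : ∀ x ∈ S, F' zz • x ∈ S := hclosed _ fun a b => by
    rw [F'_monomialVec]; exact hmem _ _
  have hH : ∀ x ∈ S, H • x ∈ S := hclosed _ fun a b => by
    rw [(isWeightVec_iff.1 (hv.1.monomialVec a b)).1]; exact S.smul_mem _ (hmem _ _)
  have hZ : ∀ x ∈ S, Z • x ∈ S := hclosed _ fun a b => by
    rw [(isWeightVec_iff.1 (hv.1.monomialVec a b)).2]; exact S.smul_mem _ (hmem _ _)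
  have hF : ∀ x ∈ S, F • x ∈ S := fun x hx => by
    have h := F'_smul (zz := zz) x
    rw [eq_sub_of_add_eq h.symm]
    exact S.sub_mem (hF' x hx) (S.smul_mem _ (hQ _ (hQ _ hx)))
  have hP : ∀ x ∈ S, P • x ∈ S := hclosed _ fun a b => by
    induction b with
    | zero => rw [hv.P_monomialVec_zero hzz]; exact S.zero_mem
    | succ b ih => rw [← Q_monomialVec, P_Q]; exact S.add_mem (hQ _ ih) (hZ _ (hmem _ _))
  have hE : ∀ x ∈ S, E • x ∈ S := hclosed _ fun a b => by
    induction b with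
    | zero =>
      induction a with
      | zero => rw [monomialVec_zero_zero, hv.2.1]; exact S.zero_mem
      | succ a ih =>
        rw [← F'_monomialVec, E_F' hzz (isWeightVec_iff.1 (hv.1.monomialVec a 0)).2]
        exact S.add_mem (S.add_mem (S.add_mem (hF' _ ih) (hH _ (hmem _ _)))
          (S.smul_mem _ (hmem _ _))) (S.smul_mem _ (hQ _ (hP _ (hmem _ _))))
    | succ b ih => rw [← Q_monomialVec, E_Q]; exact S.add_mem (hQ _ ih) (hP _ (hmem _ _))
  have hall : ∀ x ∈ S, u • x ∈ S := by
    induction u using U_induction with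
    | scalar a => intro x hx; rw [sc_smul]; exact S.smul_mem _ hx
    | gens g => cases g; exacts [hE, hH, hF, hP, hQ, hZ]
    | mul a b ha hb => intro x hx; rw [mul_smul]; exact ha _ (hb _ hx)
    | add a b ha hb => intro x hx; rw [add_smul]; exact S.add_mem (ha _ hx) (hb _ hx)
  exact hall v (by simpa [monomialVec_zero_zero] using hmem 0 0)

end HighestWeight

instance vermaModule (hh zz : ℂ) : Module ℂ (Verma hh zz) := cmod (Verma hh zz)

instance vermaSMul (hh zz : ℂ) : SMul ℂ (Verma hh zz) := (vermaModule hh zz).toSMul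

instance vermaIsScalarTower (hh zz : ℂ) : IsScalarTower ℂ U (Verma hh zz) where
  smul_assoc c u x := by
    rw [Algebra.smul_def, mul_smul]
    rfl

section HighestWeightMap

variable {M : Type} [AddCommGroup M] [Module U M]

/-- The homomorphism from the Verma module sending the canonical generator to a given singular
vector. -/
def vermaLift {hh zz : ℂ} (v : M) (hv : IsSingular hh zz v) : Verma hh zz →ₗ[U] M :=
  (vermaIdeal hh zz).liftQ (LinearMap.toSpanSingleton U M v) <| by
    rw [vermaIdeal, Submodule.span_le]
    have h := sub_eq_zero.2 hv.1.1
    have h' := sub_eq_zero.2 hv.1.2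
    rw [← sub_smul] at h h'
    rintro u (rfl | rfl | rfl | rfl)
    exacts [hv.2.1, hv.2.2, h, h']

lemma vermaLift_hwVec {hh zz : ℂ} (v : M) (hv : IsSingular hh zz v) :
    vermaLift v hv (hwVec hh zz) = v := by
  simp [vermaLift, hwVec]

lemma mk_eq_smul_hwVec (hh zz : ℂ) (u : U) :
    (Submodule.Quotient.mk u : Verma hh zz) = u • hwVec hh zz := by
  rw [hwVec, ← Submodule.Quotient.mk_smul, smul_eq_mul, mul_one]

lemma hwVec_isSingular (hh zz : ℂ) : IsSingular hh zz (hwVec hh zz) := by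
  have key : ∀ u ∈ ({E, P, H - sc hh, Z - sc zz} : Set U), u • hwVec hh zz = 0 := by
    intro u hu
    rw [← mk_eq_smul_hwVec, Submodule.Quotient.mk_eq_zero]
    exact Submodule.subset_span hu
  refine ⟨⟨?_, ?_⟩, key _ (by simp), key _ (by simp)⟩
  · exact sub_eq_zero.1 (by rw [← sub_smul]; exact key _ (by simp))
  · exact sub_eq_zero.1 (by rw [← sub_smul]; exact key _ (by simp))

end HighestWeightMap

section Coordinates

variable (n : ℂ) {zz : ℂ}

lemma Fock.vacuum_isSingular (hzz : zz ≠ 0) : IsSingular n zz (Fock.basisVec n zz hzz 0 0) := by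
  refine ⟨isWeightVec_iff.2 ⟨?_, ?_⟩, ?_, ?_⟩
  · refine (Fock.gen_smul .H _).trans ?_
    refine funext fun a => funext fun b => ?_
    change (n - 2 * a - b) * (if a = 0 ∧ b = 0 then 1 else 0)
      = n * (if a = 0 ∧ b = 0 then (1 : ℂ) else 0)
    split_ifs with h
    · simp [h.1, h.2]
    · simp
  · exact Fock.gen_smul .Z _
  · refine (Fock.gen_smul .E _).trans ?_
    refine funext fun a => funext fun b => ?_
    change (a + 1) * (n + 1 / 2 - a) * (if a + 1 = 0 ∧ b = 0 then 1 else 0)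
      + zz * ((b + 2) * (b + 1) / 2) * (if a = 0 ∧ b + 2 = 0 then 1 else 0) = (0 : ℂ)
    simp
  · refine (Fock.gen_smul .P _).trans ?_
    refine funext fun a => funext fun b => ?_
    change zz * (b + 1) * (if a = 0 ∧ b + 1 = 0 then 1 else 0) = (0 : ℂ)
    simp

/-- The coordinates of a vector of the Verma module in the basis `f'^a q^b v`. -/
def coord (hzz : zz ≠ 0) (x : Verma n zz) (a b : ℕ) : ℂ :=
  vermaLift _ (Fock.vacuum_isSingular n hzz) x a b

variable {n}

lemma coord_gen (hzz : zz ≠ 0) (i : Gen) (x : Verma n zz) (a b : ℕ) :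
    coord n hzz (gen i • x) a b = fockOp n zz i (coord n hzz x) a b := by
  change vermaLift _ (Fock.vacuum_isSingular n hzz) (gen i • x) a b = _
  rw [map_smul, Fock.gen_smul]
  rfl

/-- A single coordinate as a linear form. -/
def coordLin (hzz : zz ≠ 0) (n : ℂ) (a b : ℕ) : Verma n zz →ₗ[ℂ] ℂ where
  toFun x := coord n hzz x a b
  map_add' x y := by simp only [coord, map_add]; rfl
  map_smul' c x := by
    simp only [coord, LinearMap.map_smul_of_tower, RingHom.id_apply]
    rfl

lemma coordLin_apply (hzz : zz ≠ 0) (x : Verma n zz) (a b : ℕ) :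
    coordLin hzz n a b x = coord n hzz x a b := rfl

lemma coord_F' (hzz : zz ≠ 0) (x : Verma n zz) (a b : ℕ) :
    coord n hzz (F' zz • x) a b = if a = 0 then 0 else coord n hzz x (a - 1) b := by
  change coordLin hzz n a b _ = _
  rw [F'_smul, map_add, LinearMap.map_smul]
  change coord n hzz (gen .F • x) a b + _ • coord n hzz (gen .Q • gen .Q • x) a b = _
  simp only [coord_gen, fockOp_F, fockOp_Q, smul_eq_mul]
  rcases b with _ | _ | b <;> simp

lemma coord_monomialVec (hzz : zz ≠ 0) (i j a b : ℕ) :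
    coord n hzz (monomialVec zz (hwVec n zz) i j) a b = if a = i ∧ b = j then 1 else 0 := by
  induction j generalizing b with
  | succ j ih =>
    rw [← Q_monomialVec]
    refine (coord_gen hzz .Q _ a b).trans ?_
    rw [fockOp_Q]
    rcases b with _ | b
    · simp
    · simp [ih]
  | zero =>
    induction i generalizing a with
    | zero =>
      rw [monomialVec_zero_zero, coord, vermaLift_hwVec]
      rfl
    | succ i ih =>
      rw [← F'_monomialVec, coord_F']
      rcases a with _ | a
      · simp
      · simp [ih]

/-- Every vector of the Verma module is the finite combination of the monomials `f'^a q^b v`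
given by its coordinates. -/
lemma exists_finsupp_coord (hzz : zz ≠ 0) (x : Verma n zz) : ∃ c : ℕ × ℕ →₀ ℂ,
    (c.sum fun i r => r • monomialVec zz (hwVec n zz) i.1 i.2) = x ∧
      ∀ a b, coord n hzz x a b = c (a, b) := by
  obtain ⟨u, rfl⟩ := Submodule.Quotient.mk_surjective _ x
  rw [mk_eq_smul_hwVec]
  obtain ⟨c, hc⟩ := Finsupp.mem_span_range_iff_exists_finsupp.1
    ((hwVec_isSingular n zz).smul_mem_span hzz u)
  refine ⟨c, hc, fun a b => ?_⟩
  rw [← coordLin_apply, ← hc, map_finsuppSum]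
  simp only [LinearMap.map_smul]
  have h : ∀ i : ℕ × ℕ, coordLin hzz n a b (monomialVec zz (hwVec n zz) i.1 i.2)
      = if i = (a, b) then 1 else 0 := fun i => by
    refine (coord_monomialVec hzz i.1 i.2 a b).trans (if_congr ?_ rfl rfl)
    rw [Prod.ext_iff, eq_comm, eq_comm (a := b)]
  simp [h]
  exact Eq.symm

lemma coord_ext (hzz : zz ≠ 0) {x y : Verma n zz}
    (h : ∀ a b, coord n hzz x a b = coord n hzz y a b) : x = y := by
  obtain ⟨c, rfl, hc⟩ := exists_finsupp_coord hzz x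
  obtain ⟨d, rfl, hd⟩ := exists_finsupp_coord hzz y
  have : c = d := Finsupp.ext fun i => by rw [← hc, ← hd, h]
  rw [this]

lemma coord_zero (hzz : zz ≠ 0) (a b : ℕ) : coord n hzz 0 a b = 0 := map_zero (coordLin hzz n a b)

lemma exists_coord_bound (hzz : zz ≠ 0) (x : Verma n zz) :
    ∃ D, ∀ a b, D ≤ 2 * a + b → coord n hzz x a b = 0 := by
  obtain ⟨c, -, hc⟩ := exists_finsupp_coord hzz x
  refine ⟨c.support.sup (fun i => 2 * i.1 + i.2) + 1, fun a b hab => ?_⟩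
  rw [hc]
  by_contra h
  have := Finset.le_sup (f := fun i : ℕ × ℕ => 2 * i.1 + i.2) (Finsupp.mem_support_iff.2 h)
  simp only at this
  omega

/-- A nonzero weight vector of `Δ(n)` has weight `n - 2 * a - b` for some `a b : ℕ`. -/
lemma verma_weight (hzz : zz ≠ 0) {hh z' : ℂ} {x : Verma n zz} (hx0 : x ≠ 0)
    (hx : IsWeightVec hh z' x) :
    z' = zz ∧ ∃ a b : ℕ, hh = n - 2 * a - b := by
  obtain ⟨a, b, hab⟩ : ∃ a b, coord n hzz x a b ≠ 0 := by
    by_contra! h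
    exact hx0 (coord_ext hzz fun a b => by rw [h, coord_zero])
  rw [isWeightVec_iff] at hx
  have h1 : coord n hzz (gen .H • x) a b = hh * coord n hzz x a b := by
    change coordLin hzz n a b (H • x) = _
    rw [hx.1, map_smul]; rfl
  have h2 : coord n hzz (gen .Z • x) a b = z' * coord n hzz x a b := by
    change coordLin hzz n a b (Z • x) = _
    rw [hx.2, map_smul]; rfl
  rw [coord_gen, fockOp_H] at h1
  rw [coord_gen, fockOp_Z] at h2
  exact ⟨(mul_right_cancel₀ hab h2).symm, a, b, (mul_right_cancel₀ hab h1).symm⟩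

lemma int_add_half_ne (n : ℤ) : (n : ℂ) + 1 / 2 ≠ 0 := by
  intro h
  have h2 : ((2 * n + 1 : ℤ) : ℂ) = 0 := by push_cast; linear_combination 2 * h
  have h3 : (2 * n + 1 : ℤ) = 0 := by exact_mod_cast h2
  omega

lemma verma_isSimple (hzz : zz ≠ 0) (n : ℤ) : IsSimpleModule U (Verma (n : ℂ) zz) := by
  have hgen : ∀ N : Submodule U (Verma (n : ℂ) zz), hwVec n zz ∈ N → N = ⊤ := by
    refine fun N hN => top_le_iff.1 fun x _ => ?_
    obtain ⟨u, rfl⟩ := Submodule.Quotient.mk_surjective _ x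
    rw [mk_eq_smul_hwVec]
    exact N.smul_mem u hN
  have hcoord : ∀ a b, coord (n : ℂ) hzz (hwVec n zz) a b = if a = 0 ∧ b = 0 then 1 else 0 := by
    intro a b
    rw [← monomialVec_zero_zero (zz := zz) (hwVec (n : ℂ) zz), coord_monomialVec]
  have hne : hwVec (n : ℂ) zz ≠ 0 := by
    intro h
    have := hcoord 0 0
    rw [h, coord_zero] at this
    simp at this
  have : Nontrivial (Verma (n : ℂ) zz) := ⟨_, _, hne⟩
  rw [isSimpleModule_iff]
  refine ⟨fun N => or_iff_not_imp_left.2 fun hN => hgen N ?_⟩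
  obtain ⟨w, hwN, hw0⟩ := N.ne_bot_iff.1 hN
  classical
  have hex : ∃ D, ∃ x ∈ N, x ≠ 0 ∧ ∀ a b, D ≤ 2 * a + b → coord (n : ℂ) hzz x a b = 0 := by
    obtain ⟨D, hD⟩ := exists_coord_bound hzz w
    exact ⟨D, w, hwN, hw0, hD⟩
  obtain ⟨x, hxN, hx0, hx⟩ := Nat.find_spec hex
  have hmin : ∀ y ∈ N, (∀ a b, Nat.find hex ≤ 2 * a + b + 1 → coord (n : ℂ) hzz y a b = 0) →
      y = 0 := by
    intro y hyN hy
    by_contra hy0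
    rcases Nat.eq_zero_or_pos (Nat.find hex) with h0 | hpos
    · exact hy0 (coord_ext hzz fun a b => by rw [hy a b (by omega), coord_zero])
    · exact Nat.find_min hex (Nat.sub_lt hpos one_pos)
        ⟨y, hyN, hy0, fun a b hab => hy a b (by omega)⟩
  have hP : P • x = 0 := hmin _ (N.smul_mem _ hxN) fun a b hab => by
    refine (coord_gen hzz .P x a b).trans ?_
    rw [fockOp_P, hx _ _ (by omega), mul_zero]
  have hE : E • x = 0 := hmin _ (N.smul_mem _ hxN) fun a b hab => by
    refine (coord_gen hzz .E x a b).trans ?_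
    rw [fockOp_E, hx _ _ (by omega), hx _ _ (by omega), mul_zero, mul_zero, add_zero]
  have hb : ∀ a b, coord (n : ℂ) hzz x a (b + 1) = 0 := fun a b => by
    have h := coord_gen hzz .P x a b
    rw [show gen .P • x = 0 from hP, coord_zero, fockOp_P] at h
    have hb' : (b : ℂ) + 1 ≠ 0 := by exact_mod_cast b.succ_ne_zero
    simpa [hzz, hb'] using h.symm
  have ha : ∀ a, coord (n : ℂ) hzz x (a + 1) 0 = 0 := fun a => by
    have h := coord_gen hzz .E x a 0
    rw [show gen .E • x = 0 from hE, coord_zero, fockOp_E, hb, mul_zero, add_zero] at h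
    have ha' : (a : ℂ) + 1 ≠ 0 := by exact_mod_cast a.succ_ne_zero
    have : (n : ℂ) + 1 / 2 - a ≠ 0 := by
      convert int_add_half_ne (n - a) using 1
      push_cast; ring
    exact (mul_eq_zero.1 h.symm).resolve_left (mul_ne_zero ha' this)
  have hxc : x = coord (n : ℂ) hzz x 0 0 • hwVec (n : ℂ) zz := by
    refine coord_ext hzz fun a b => ?_
    rw [← coordLin_apply hzz (_ • _), LinearMap.map_smul, coordLin_apply, hcoord]
    rcases a with _ | a <;> rcases b with _ | b <;> simp [ha, hb]
  have hc0 : coord (n : ℂ) hzz x 0 0 ≠ 0 := fun h =>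
    hx0 (hxc.trans (by rw [h]; exact zero_smul ℂ _))
  have : hwVec (n : ℂ) zz = sc (coord (n : ℂ) hzz x 0 0)⁻¹ • x := by
    rw [sc_smul]
    exact (inv_smul_eq_iff₀ hc0).2 hxc |>.symm
  rw [this]
  exact N.smul_mem _ hxN

end Coordinates

section Lifting

variable {M : Type} [AddCommGroup M] [Module U M]

/-- If a power of `u` kills a vector outside `N`, some iterate of `u` is outside `N` while the next
one is in `N`. -/
lemma exists_last_pow_notMem (N : Submodule U M) (u : U) {v : M} (hv : v ∉ N)
    (h : ∃ k, u ^ k • v = 0) : ∃ k, u ^ k • v ∉ N ∧ u • u ^ k • v ∈ N := by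
  classical
  have hex : ∃ k, u ^ k • v ∈ N := by
    obtain ⟨k, hk⟩ := h
    exact ⟨k, hk ▸ N.zero_mem⟩
  have hpos : Nat.find hex ≠ 0 := fun h0 => hv (by simpa [h0] using Nat.find_spec hex)
  obtain ⟨k, hk⟩ := Nat.exists_eq_succ_of_ne_zero hpos
  refine ⟨k, Nat.find_min hex (by omega), ?_⟩
  have := Nat.find_spec hex
  rwa [hk, Nat.succ_eq_add_one, pow_succ', mul_smul] at this

variable [Module ℂ M] [IsScalarTower ℂ U M] {hh zz : ℂ}

lemma IsWeightVec.smul {x : M} (hx : IsWeightVec hh zz x) (c : ℂ) :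
    IsWeightVec hh zz (c • x) := by
  rw [isWeightVec_iff] at *
  rw [smul_scalar, smul_scalar, hx.1, hx.2, smul_comm c, smul_comm c]
  exact ⟨rfl, rfl⟩

lemma IsWeightVec.add {x y : M} (hx : IsWeightVec hh zz x) (hy : IsWeightVec hh zz y) :
    IsWeightVec hh zz (x + y) := by
  rw [isWeightVec_iff] at *
  exact ⟨by rw [smul_add, hx.1, hy.1, smul_add], by rw [smul_add, hx.2, hy.2, smul_add]⟩

lemma IsWeightVec.sub {x y : M} (hx : IsWeightVec hh zz x) (hy : IsWeightVec hh zz y) :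
    IsWeightVec hh zz (x - y) := by
  rw [isWeightVec_iff] at *
  exact ⟨by rw [smul_sub, hx.1, hy.1, smul_sub], by rw [smul_sub, hx.2, hy.2, smul_sub]⟩

omit [Module ℂ M] [IsScalarTower ℂ U M] in
lemma IsWeightVec.pow_smul {u : U} {s : ℂ}
    (hu : ∀ (t : ℂ) (x : M), IsWeightVec t zz x → IsWeightVec (t + s) zz (u • x))
    {x : M} (hx : IsWeightVec hh zz x) (k : ℕ) : IsWeightVec (hh + k * s) zz (u ^ k • x) := by
  induction k with
  | zero => simpa using hx
  | succ k ih =>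
    rw [pow_succ', mul_smul]
    convert hu _ _ ih using 1
    push_cast; ring

lemma P_pow_Q (k : ℕ) {x : M} (hx : Z • x = zz • x) :
    P ^ (k + 1) • Q • x = Q • P ^ (k + 1) • x + ((k + 1) * zz) • P ^ k • x := by
  induction k with
  | zero => simp [P_Q, hx]
  | succ k ih =>
    rw [pow_succ', mul_smul, ih, smul_add, P_Q, Z_smul _ hx, smul_scalar, ← mul_smul P,
      ← mul_smul P, ← pow_succ', ← pow_succ']
    generalize P ^ (k + 1) • x = y₁, Q • P ^ (k + 1 + 1) • x = y₂
    push_cast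
    module

/-- `P` acts surjectively on weight vectors on which it is nilpotent. -/
lemma exists_P_smul_eq (hzz : zz ≠ 0) (N : Submodule U M) (k : ℕ) {u : M} (huN : u ∈ N)
    (hu : IsWeightVec (hh + 1) zz u) (hk : P ^ k • u = 0) :
    ∃ y ∈ N, IsWeightVec hh zz y ∧ P • y = u := by
  induction k generalizing u with
  | zero =>
    refine ⟨0, N.zero_mem, by simp [IsWeightVec], ?_⟩
    rw [smul_zero]
    simpa using hk.symm
  | succ k ih =>
    have hc : ((k : ℂ) + 1) * zz ≠ 0 := mul_ne_zero (by exact_mod_cast k.succ_ne_zero) hzz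
    set y₀ : M := (((k : ℂ) + 1) * zz)⁻¹ • Q • u with hy₀
    have hy₀N : y₀ ∈ N := by rw [hy₀, ← sc_smul]; exact N.smul_mem _ (N.smul_mem _ huN)
    have hy₀w : IsWeightVec hh zz y₀ := by
      have := hu.Q_smul.smul (((k : ℂ) + 1) * zz)⁻¹
      rwa [add_sub_cancel_right] at this
    obtain ⟨y, hyN, hy, hPy⟩ := ih (N.sub_mem huN (N.smul_mem P hy₀N)) (hu.sub hy₀w.P_smul) (by
      rw [smul_sub, ← mul_smul, ← pow_succ, hy₀, smul_scalar,
        P_pow_Q k (isWeightVec_iff.1 hu).2, hk, smul_zero, zero_add, inv_smul_smul₀ hc, sub_self])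
    exact ⟨y + y₀, N.add_mem hyN hy₀N, hy.add hy₀w, by rw [smul_add, hPy, sub_add_cancel]⟩

omit [Module ℂ M] [IsScalarTower ℂ U M] in
lemma P_E_pow (k : ℕ) {x : M} (hx : P • x = 0) : P • E ^ k • x = 0 := by
  induction k with
  | zero => simpa using hx
  | succ k ih => rw [pow_succ', mul_smul, ← E_P, ih, smul_zero]

lemma E_pow_F' (hzz : zz ≠ 0) (k : ℕ) {x : M} (hx : IsWeightVec hh zz x) (hP : P • x = 0) :
    E ^ (k + 1) • F' zz • x
      = F' zz • E ^ (k + 1) • x + ((k + 1) * (hh + k + 1 / 2)) • E ^ k • x := by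
  induction k with
  | zero =>
    simp only [zero_add, pow_one, pow_zero, one_smul]
    rw [E_F' hzz (isWeightVec_iff.1 hx).2, hP, (isWeightVec_iff.1 hx).1, smul_zero, smul_zero]
    generalize F' zz • E • x = y
    push_cast
    module
  | succ k ih =>
    have hw := isWeightVec_iff.1 (hx.pow_smul (fun _ _ h => h.E_smul) (k + 1))
    rw [pow_succ', mul_smul, ih, smul_add, E_F' hzz hw.2, hw.1, P_E_pow _ hP, smul_zero, smul_zero,
      smul_scalar, ← mul_smul E, ← mul_smul E, ← pow_succ', ← pow_succ']
    generalize E ^ (k + 1) • x = y₁, F' zz • E ^ (k + 1 + 1) • x = y₂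
    push_cast
    module

/-- On the kernel of `P`, `E` acts surjectively on vectors of integral weight on which it is
nilpotent. -/
lemma exists_E_smul_eq (hzz : zz ≠ 0) (n : ℤ) (N : Submodule U M) (k : ℕ) {u : M} (huN : u ∈ N)
    (hu : IsWeightVec ((n : ℂ) + 2) zz u) (hP : P • u = 0) (hk : E ^ k • u = 0) :
    ∃ y ∈ N, IsWeightVec (n : ℂ) zz y ∧ P • y = 0 ∧ E • y = u := by
  induction k generalizing u with
  | zero =>
    refine ⟨0, N.zero_mem, by simp [IsWeightVec], smul_zero _, ?_⟩
    rw [smul_zero]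
    simpa using hk.symm
  | succ k ih =>
    set c : ℂ := ((k : ℂ) + 1) * ((n : ℂ) + 2 + k + 1 / 2) with hcdef
    have hc : c ≠ 0 := mul_ne_zero (by exact_mod_cast k.succ_ne_zero)
      (by exact_mod_cast int_add_half_ne (n + 2 + k))
    set y₀ : M := c⁻¹ • F' zz • u with hy₀
    have hy₀N : y₀ ∈ N := by rw [hy₀, ← sc_smul]; exact N.smul_mem _ (N.smul_mem _ huN)
    have hy₀w : IsWeightVec (n : ℂ) zz y₀ := by simpa using hu.F'_smul.smul c⁻¹
    have hy₀P : P • y₀ = 0 := by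
      rw [hy₀, smul_scalar, P_F' hzz (isWeightVec_iff.1 hu).2, hP, smul_zero, smul_zero]
    obtain ⟨y, hyN, hy, hPy, hEy⟩ := ih (N.sub_mem huN (N.smul_mem E hy₀N)) (hu.sub hy₀w.E_smul)
      (by rw [smul_sub, hP, ← E_P, hy₀P, smul_zero, sub_zero]) (by
        rw [smul_sub, ← mul_smul, ← pow_succ, hy₀, smul_scalar, E_pow_F' hzz k hu hP, hk,
          smul_zero, zero_add, ← hcdef, inv_smul_smul₀ hc, sub_self])
    exact ⟨y + y₀, N.add_mem hyN hy₀N, hy.add hy₀w, by rw [smul_add, hPy, hy₀P, add_zero],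
      by rw [smul_add, hEy, sub_add_cancel]⟩

/-- A singular vector acts by the scalar `ϑ` under the Casimir element. -/
lemma IsSingular.cElt_smul {v : M} (hv : IsSingular hh zz v) : cElt • v = vartheta hh zz • v := by
  obtain ⟨hw, hE, hP⟩ := hv
  obtain ⟨hH, hZ⟩ := isWeightVec_iff.1 hw
  have hEZ : E • Z • v = Z • E • v := gen_Z .E v
  have hPQ : P • Q • v = zz • v := by rw [P_Q, hP, hZ, smul_zero, zero_add]
  have hEQ : E • Q • v = 0 := by rw [E_Q, hE, hP, smul_zero, add_zero]
  rw [Schrodinger.cElt_smul, hEZ, hE, hP, E_Q, hEQ, hPQ, hZ, smul_scalar, hH]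
  simp only [smul_zero, smul_scalar, hH, vartheta]
  module

end Lifting

section CategoryO

lemma isScalarTower_cmod (M : Type) [AddCommGroup M] [Module U M] :
    letI := cmod M
    IsScalarTower ℂ U M :=
  let := cmod M
  ⟨fun c u x => by rw [Algebra.smul_def, mul_smul]; rfl⟩

/-- In a module of category `O`, elements of `U(n₊)` that shift weights are locally nilpotent on
weight vectors. -/
lemma InO.exists_pow_smul_eq_zero {M : Type} [AddCommGroup M] [Module U M] (hM : InO M) {u : U}
    (hu : u ∈ nPlus) {hh zz s : ℂ} (hs : s ≠ 0)
    (hshift : ∀ (t : ℂ) (x : M), IsWeightVec t zz x → IsWeightVec (t + s) zz (u • x))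
    {v : M} (hv : IsWeightVec hh zz v) : ∃ k, u ^ k • v = 0 := by
  let := cmod M
  have := isScalarTower_cmod M
  by_contra! hne
  obtain ⟨W, hW, hWu⟩ := hM.2.2 v
  have hli : LinearIndependent ℂ fun k : ℕ => u ^ k • v := by
    refine Module.End.eigenvectors_linearIndependent' (Algebra.lsmul ℂ ℂ M H)
      (fun k : ℕ => hh + k * s) (fun k l hkl => ?_) _ fun k => ⟨?_, hne k⟩
    · have := mul_right_cancel₀ hs (add_left_cancel hkl)
      exact_mod_cast this
    · rw [Module.End.mem_eigenspace_iff]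
      exact (isWeightVec_iff.1 (hv.pow_smul hshift k)).1
  have hli₂ : LinearIndependent ℂ fun k : ℕ => (⟨u ^ k • v, hWu _ (pow_mem hu k)⟩ : W) :=
    LinearIndependent.of_comp W.subtype hli
  exact Module.Finite.not_linearIndependent_of_infinite _ hli₂

/-- A module in an integral block of nonzero central charge is generated by its singular vectors. -/
lemma span_singular_eq_top {zz : ℂ} (hzz : zz ≠ 0) (M : ModuleCat.{0} U) (hM : InBlock 0 zz M) :
    Submodule.span U {v : M | ∃ n : ℤ, IsSingular (n : ℂ) zz v} = ⊤ := by
  let := cmod M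
  have := isScalarTower_cmod M
  set N := Submodule.span U {v : M | ∃ n : ℤ, IsSingular (n : ℂ) zz v} with hN
  have hEn : ∀ {hh : ℂ} {x : M}, IsWeightVec hh zz x → ∃ k, E ^ k • x = 0 := fun hx =>
    hM.1.exists_pow_smul_eq_zero (Algebra.subset_adjoin (by simp)) two_ne_zero
      (fun _ _ h => h.E_smul) hx
  have hPn : ∀ {hh : ℂ} {x : M}, IsWeightVec hh zz x → ∃ k, P ^ k • x = 0 := fun hx =>
    hM.1.exists_pow_smul_eq_zero (Algebra.subset_adjoin (by simp)) one_ne_zero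
      (fun _ _ h => h.P_smul) hx
  by_contra hNtop
  obtain ⟨v, ⟨n, hv⟩, hvN⟩ : ∃ v : M, (∃ n : ℤ, IsWeightVec (n : ℂ) zz v) ∧ v ∉ N := by
    by_contra! hall
    refine hNtop (top_le_iff.1 fun x _ => ?_)
    have hle : AddSubgroup.closure {w : M | ∃ hh zz : ℂ, IsWeightVec hh zz w} ≤
        N.toAddSubgroup := by
      rw [AddSubgroup.closure_le]
      rintro w ⟨hh, z', hw⟩
      by_cases hw0 : w = 0
      · exact hw0 ▸ N.zero_mem
      · obtain ⟨rfl, n, rfl⟩ := hM.2 w hh z' hw0 hw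
        exact hall w ⟨n, by simpa using hw⟩
    exact hle (hM.1.2.1 x)
  obtain ⟨k, hkN, hkP⟩ := exists_last_pow_notMem N P hvN (hPn hv)
  have hw := hv.pow_smul (fun _ _ h => h.P_smul) k
  obtain ⟨l, hlN, hlE⟩ := exists_last_pow_notMem N E hkN (hEn hw)
  have hw' := hw.pow_smul (fun _ _ h => h.E_smul) l
  set x : M := E ^ l • P ^ k • v with hx
  have hPx : P • x ∈ N := by
    have : ∀ l : ℕ, P • E ^ l • P ^ k • v ∈ N := fun l => by
      induction l with
      | zero => simpa using hkP
      | succ l ih => rw [pow_succ', mul_smul, ← E_P]; exact N.smul_mem _ ih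
    exact this l
  obtain ⟨m, hm⟩ : ∃ m : ℤ, IsWeightVec (m : ℂ) zz x :=
    ⟨n + k + l * 2, by convert hw' using 1; push_cast; ring⟩
  obtain ⟨k', hk'⟩ := hPn hm.P_smul
  obtain ⟨y, hyN, hy, hPy⟩ := exists_P_smul_eq hzz N k' hPx hm.P_smul hk'
  have hP0 : P • (x - y) = 0 := by rw [smul_sub, hPy, sub_self]
  have hxy := hm.sub hy
  obtain ⟨l', hl'⟩ := hEn hxy.E_smul
  obtain ⟨y', hyN', hy', hPy', hEy'⟩ := exists_E_smul_eq hzz m N l'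
    (by rw [smul_sub]; exact N.sub_mem hlE (N.smul_mem _ hyN)) hxy.E_smul
    (by rw [← E_P, hP0, smul_zero]) hl'
  have hsing : x - y - y' ∈ N := Submodule.subset_span
    ⟨m, hxy.sub hy', by rw [smul_sub, hEy', sub_self], by rw [smul_sub, hP0, hPy', sub_self]⟩
  exact hlN ((N.sub_mem_iff_left hyN).1 ((N.sub_mem_iff_left hyN').1 hsing))

lemma block_isSemisimple {zz : ℂ} (hzz : zz ≠ 0) (M : ModuleCat.{0} U) (hM : InBlock 0 zz M) :
    IsSemisimpleModule U M := by
  rw [← sSup_simples_eq_top_iff_isSemisimpleModule, ← top_le_iff,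
    ← span_singular_eq_top hzz M hM, Submodule.span_le]
  rintro v ⟨n, hv⟩
  by_cases hv0 : v = 0
  · rw [hv0]; exact Submodule.zero_mem _
  · have := verma_isSimple hzz n
    have hne : vermaLift v hv ≠ 0 := fun h => hv0 (by rw [← vermaLift_hwVec v hv, h]; rfl)
    have hle := le_sSup (a := LinearMap.range (vermaLift v hv))
      (s := {m : Submodule U M | IsSimpleModule U m})
      (IsSimpleModule.congr (LinearEquiv.ofInjective _ (LinearMap.injective_of_ne_zero hne)).symm)
    exact hle ⟨_, vermaLift_hwVec v hv⟩

/-- Every simple object of an integral block of nonzero central charge is a Verma module. -/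
lemma exists_equiv_verma {zz : ℂ} (hzz : zz ≠ 0) (M : ModuleCat.{0} U) (hM : InBlock 0 zz M)
    [IsSimpleModule U M] : ∃ n : ℤ, Nonempty ((M : Type) ≃ₗ[U] Verma (n : ℂ) zz) := by
  have := IsSimpleModule.nontrivial U M
  obtain ⟨v, ⟨n, hv⟩, hv0⟩ : ∃ v : M, (∃ n : ℤ, IsSingular (n : ℂ) zz v) ∧ v ≠ 0 := by
    by_contra! h
    apply bot_ne_top (α := Submodule U M)
    rw [← span_singular_eq_top hzz M hM, eq_comm, Submodule.span_eq_bot]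
    exact h
  have := verma_isSimple hzz n
  have hne : vermaLift v hv ≠ 0 := fun h => hv0 (by rw [← vermaLift_hwVec v hv, h]; rfl)
  exact ⟨n, ⟨(LinearEquiv.ofBijective _ (LinearMap.bijective_of_ne_zero hne)).symm⟩⟩

end CategoryO

section Closure

lemma cElt_central' {M : Type} [AddCommGroup M] [Module U M] (u : U) (x : M) :
    cElt • u • x = u • cElt • x := by
  let := cmod M
  have := isScalarTower_cmod M
  exact cElt_central u x

lemma IsWeightVec.map {M N : Type} [AddCommGroup M] [Module U M] [AddCommGroup N] [Module U N]
    {hh zz : ℂ} {v : M} (hv : IsWeightVec hh zz v) (f : M →ₗ[U] N) : IsWeightVec hh zz (f v) := by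
  constructor
  · rw [← map_smul, hv.1, map_smul]
  · rw [← map_smul, hv.2, map_smul]

/-- A quotient of a module of category `O` is in category `O`. -/
lemma InO.of_surjective {M N : Type} [AddCommGroup M] [Module U M] [AddCommGroup N] [Module U N]
    (hM : InO M) (f : M →ₗ[U] N) (hf : Function.Surjective f) : InO N := by
  have := hM.1
  refine ⟨Module.Finite.of_surjective f hf, fun v => ?_, ?_⟩
  · obtain ⟨x, rfl⟩ := hf v
    have hx := AddSubgroup.mem_map_of_mem f.toAddMonoidHom (hM.2.1 x)
    rw [AddMonoidHom.map_closure] at hx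
    refine AddSubgroup.closure_mono ?_ hx
    rintro _ ⟨w, ⟨hh, zz, hw⟩, rfl⟩
    exact ⟨hh, zz, hw.map f⟩
  · let := cmod M
    let := cmod N
    have := isScalarTower_cmod M
    have := isScalarTower_cmod N
    intro v
    obtain ⟨x, rfl⟩ := hf v
    obtain ⟨W, hW, hWu⟩ := hM.2.2 x
    refine ⟨W.map (f.restrictScalars ℂ), inferInstance, fun u hu => ?_⟩
    exact ⟨u • x, hWu u hu, map_smul f u x⟩

/-- A retract of a module in a block is in the block. -/
lemma InBlock.of_retract {hh0 zz0 : ℂ} {M N : ModuleCat.{0} U} (hM : InBlock hh0 zz0 M)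
    (i : N →ₗ[U] M) (r : M →ₗ[U] N) (h : r ∘ₗ i = LinearMap.id) : InBlock hh0 zz0 N := by
  have hri : Function.LeftInverse r i := fun x => LinearMap.congr_fun h x
  refine ⟨hM.1.of_surjective r hri.surjective, fun v hh zz hv0 hv => ?_⟩
  exact hM.2 (i v) hh zz (fun h0 => hv0 (hri.injective (h0.trans (map_zero i).symm))) (hv.map i)

variable {zz : ℂ} (hzz : zz ≠ 0)
include hzz

lemma InBlock.submodule {M : ModuleCat.{0} U} (hM : InBlock 0 zz M) (N : Submodule U M) :
    InBlock 0 zz (ModuleCat.of U N) := by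
  have := block_isSemisimple hzz M hM
  obtain ⟨r, hr⟩ := IsSemisimpleModule.extension_property N.subtype N.injective_subtype
    LinearMap.id
  exact hM.of_retract (N := ModuleCat.of U N) N.subtype r hr

lemma InBlock.quotient {M : ModuleCat.{0} U} (hM : InBlock 0 zz M) (N : Submodule U M) :
    InBlock 0 zz (ModuleCat.of U ((M : Type) ⧸ N)) := by
  have := block_isSemisimple hzz M hM
  obtain ⟨s, hs⟩ := IsSemisimpleModule.lifting_property N.mkQ N.mkQ_surjective LinearMap.id
  exact hM.of_retract (N := ModuleCat.of U ((M : Type) ⧸ N)) s N.mkQ hs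

lemma gen_coord_eq_zero {n : ℂ} {D : ℕ} {x : Verma n zz}
    (hx : ∀ a b, D ≤ 2 * a + b → coord n hzz x a b = 0) {g : U} (hg : g ∈ ({E, P} : Set U)) :
    ∀ a b, D ≤ 2 * a + b → coord n hzz (g • x) a b = 0 := by
  intro a b hab
  rcases hg with rfl | rfl
  · refine (coord_gen hzz .E x a b).trans ?_
    rw [fockOp_E, hx _ _ (by omega), hx _ _ (by omega), mul_zero, mul_zero, add_zero]
  · refine (coord_gen hzz .P x a b).trans ?_
    rw [fockOp_P, hx _ _ (by omega), mul_zero]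

/-- Verma modules of integral weight lie in the integral block. -/
lemma verma_inBlock (n : ℤ) : InBlock 0 zz (VermaC (n : ℂ) zz) := by
  refine ⟨⟨?_, fun (x : Verma (n : ℂ) zz) => ?_, fun (x : Verma (n : ℂ) zz) => ?_⟩,
    fun (x : Verma (n : ℂ) zz) hh z' hx0 hx => ?_⟩
  · exact inferInstanceAs (Module.Finite U (Verma (n : ℂ) zz))
  · obtain ⟨c, rfl, -⟩ := exists_finsupp_coord hzz x
    refine AddSubgroup.sum_mem _ fun i _ => AddSubgroup.subset_closure ?_
    exact ⟨_, _, ((hwVec_isSingular (n : ℂ) zz).1.monomialVec i.1 i.2).smul _⟩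
  · obtain ⟨D, hD⟩ := exists_coord_bound hzz x
    let W : Submodule ℂ (Verma (n : ℂ) zz) :=
      { carrier := {y | ∀ a b, D ≤ 2 * a + b → coordLin hzz n a b y = 0}
        zero_mem' := fun a b _ => LinearMap.map_zero _
        add_mem' := fun hy hz a b hab => by
          rw [LinearMap.map_add, hy a b hab, hz a b hab, add_zero]
        smul_mem' := fun c y hy a b hab => by rw [LinearMap.map_smul, hy a b hab, smul_zero] }
    have hfin : FiniteDimensional ℂ W := by
      let T : W →ₗ[ℂ] Fin D × Fin D → ℂ :=
        (LinearMap.pi fun i : Fin D × Fin D => coordLin hzz n i.1 i.2) ∘ₗ W.subtype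
      refine Module.Finite.of_injective T fun y z hyz => Subtype.ext (coord_ext hzz fun a b => ?_)
      by_cases hab : D ≤ 2 * a + b
      · exact (y.2 a b hab).trans (z.2 a b hab).symm
      · exact congrFun hyz (⟨a, by omega⟩, ⟨b, by omega⟩)
    refine ⟨W, hfin, fun u hu => ?_⟩
    have key : ∀ y ∈ W, u • y ∈ W := by
      induction hu using Algebra.adjoin_induction with
      | mem g hg => exact fun y hy => gen_coord_eq_zero hzz hy hg
      | algebraMap r =>
        intro y hy
        rw [algebraMap_smul]
        exact W.smul_mem r hy
      | add u v _ _ hu hv =>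
        intro y hy
        rw [add_smul]
        exact W.add_mem (hu y hy) (hv y hy)
      | mul u v _ _ hu hv =>
        intro y hy
        rw [mul_smul]
        exact hu _ (hv y hy)
    exact key x hD
  · obtain ⟨rfl, a, b, rfl⟩ := verma_weight hzz hx0 hx
    exact ⟨rfl, n - 2 * a - b, by push_cast; ring⟩

end Closure

section CentralCharacter

lemma smul_sc_smul {M : Type} [AddCommGroup M] [Module U M] (u : U) (a : ℂ) (x : M) :
    u • sc a • x = sc a • u • x := by
  rw [← mul_smul, ← mul_smul, sc, Algebra.commutes]

/-- The eigenspace of the Casimir element with eigenvalue `θ`. -/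
def casimirEigen (M : Type) [AddCommGroup M] [Module U M] (θ : ℂ) : Submodule U M where
  carrier := {x | cElt • x = sc θ • x}
  zero_mem' := by simp
  add_mem' {x y} hx hy := by
    rw [Set.mem_ofPred_eq] at *
    rw [smul_add, smul_add, hx, hy]
  smul_mem' u x hx := by
    rw [Set.mem_ofPred_eq] at *
    rw [cElt_central', hx, smul_sc_smul]

lemma mem_casimirEigen {M : Type} [AddCommGroup M] [Module U M] {θ : ℂ} {x : M} :
    x ∈ casimirEigen M θ ↔ cElt • x = sc θ • x := Iff.rfl

lemma map_mem_casimirEigen {M N : Type} [AddCommGroup M] [Module U M] [AddCommGroup N] [Module U N]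
    (f : M →ₗ[U] N) {θ : ℂ} {x : M} (hx : x ∈ casimirEigen M θ) : f x ∈ casimirEigen N θ := by
  rw [mem_casimirEigen] at *
  rw [← map_smul, hx, map_smul]

lemma eq_zero_of_mem_casimirEigen {M : Type} [AddCommGroup M] [Module U M] {θ θ' : ℂ}
    (hθ : θ ≠ θ') {x : M} (hx : x ∈ casimirEigen M θ) (hx' : x ∈ casimirEigen M θ') : x = 0 := by
  let := cmod M
  have := isScalarTower_cmod M
  have h : sc θ • x = sc θ' • x := hx.symm.trans hx'
  rw [sc_smul, sc_smul, ← sub_eq_zero, ← sub_smul] at h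
  exact (smul_eq_zero.1 h).resolve_left (sub_ne_zero.2 hθ)

lemma IsSingular.mem_casimirEigen {M : Type} [AddCommGroup M] [Module U M] {hh zz : ℂ} {v : M}
    (hv : IsSingular hh zz v) : v ∈ casimirEigen M (vartheta hh zz) := by
  let := cmod M
  have := isScalarTower_cmod M
  rw [Schrodinger.mem_casimirEigen, sc_smul]
  exact hv.cElt_smul

lemma casimirEigen_verma (hh zz : ℂ) : casimirEigen (Verma hh zz) (vartheta hh zz) = ⊤ := by
  refine top_le_iff.1 fun x _ => ?_
  obtain ⟨u, rfl⟩ := Submodule.Quotient.mk_surjective _ x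
  rw [mk_eq_smul_hwVec]
  exact Submodule.smul_mem _ u (hwVec_isSingular hh zz).mem_casimirEigen

lemma vartheta_reflect (i zz : ℂ) : vartheta (-2 - i) zz = vartheta (-1 + i) zz := by
  rw [vartheta, vartheta]; ring

variable {zz : ℂ} (hzz : zz ≠ 0)
include hzz

lemma vartheta_eq_iff (n : ℤ) (i : ℕ) : vartheta n zz = vartheta (-1 + i) zz ↔
    n = -1 + i ∨ n = -2 - i := by
  rw [vartheta, vartheta, mul_left_inj' hzz]
  constructor
  · intro h
    have h' : (n - (-1 + i)) * (n - (-2 - i)) = 0 := by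
      have : (((n - (-1 + i)) * (n - (-2 - i)) : ℤ) : ℂ) = 0 := by
        push_cast; linear_combination h
      exact_mod_cast this
    rcases mul_eq_zero.1 h' with h | h
    · exact Or.inl (by omega)
    · exact Or.inr (by omega)
  · rintro (rfl | rfl) <;> push_cast <;> ring

lemma vartheta_injective : Function.Injective fun i : ℕ => vartheta (-1 + i) zz := by
  intro i j hij
  have := (vartheta_eq_iff hzz (-1 + i) j).1 (by push_cast; exact hij)
  omega

lemma exists_vartheta_eq (n : ℤ) : ∃ i : ℕ, vartheta n zz = vartheta (-1 + i) zz := by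
  rcases le_total (-1) n with h | h
  · exact ⟨(n + 1).toNat, (vartheta_eq_iff hzz n _).2 (Or.inl (by omega))⟩
  · exact ⟨(-2 - n).toNat, (vartheta_eq_iff hzz n _).2 (by omega)⟩

lemma verma_inBlock_left (i : ℕ) : InBlock 0 zz (VermaC (-1 + (i : ℂ)) zz) := by
  have := verma_inBlock hzz (-1 + i)
  push_cast at this
  exact this

lemma verma_inBlock_right (i : ℕ) : InBlock 0 zz (VermaC (-2 - (i : ℂ)) zz) := by
  have := verma_inBlock hzz (-2 - i)
  push_cast at this
  exact this

lemma serreClassIn_casimirEigen (θ : ℂ) : SerreClassIn (InBlock 0 zz)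
    fun M => InBlock 0 zz M ∧ casimirEigen M θ = ⊤ := by
  refine ⟨fun M h => h.1, ?_, fun M N hM => ⟨fun h => ⟨⟨hM.submodule hzz N, ?_⟩,
    hM.quotient hzz N, ?_⟩, fun h => ⟨hM, ?_⟩⟩⟩
  · rintro M N ⟨e⟩ hM hN
    refine ⟨hN, top_le_iff.1 fun x _ => ?_⟩
    have := map_mem_casimirEigen e.toLinearMap (x := e.symm x) (hM.2 ▸ Submodule.mem_top)
    simpa using this
  · refine top_le_iff.1 fun (x : N) _ => Subtype.ext ?_
    have : (x : M) ∈ casimirEigen M θ := h.2 ▸ Submodule.mem_top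
    exact this
  · refine top_le_iff.1 fun (x : (M : Type) ⧸ N) _ => ?_
    obtain ⟨y, rfl⟩ := N.mkQ_surjective x
    exact map_mem_casimirEigen N.mkQ (h.2 ▸ Submodule.mem_top)
  · have := block_isSemisimple hzz M hM
    obtain ⟨s, hs⟩ := IsSemisimpleModule.lifting_property N.mkQ N.mkQ_surjective LinearMap.id
    refine top_le_iff.1 fun x _ => ?_
    have h1 : s (N.mkQ x) ∈ casimirEigen M θ :=
      map_mem_casimirEigen s (h.2.2 ▸ Submodule.mem_top : N.mkQ x ∈ casimirEigen _ θ)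
    have h2 : x - s (N.mkQ x) ∈ N := by
      refine (Submodule.Quotient.eq N).1 ?_
      exact (LinearMap.congr_fun hs (N.mkQ x)).symm
    have h3 : x - s (N.mkQ x) ∈ casimirEigen M θ :=
      map_mem_casimirEigen N.subtype
        (h.1.2 ▸ Submodule.mem_top : (⟨_, h2⟩ : N) ∈ casimirEigen N θ)
    simpa using (casimirEigen M θ).add_mem h3 h1

/-- A simple object of the integral block on which the Casimir element acts by the scalar of
`Δ(-1 + i)` is one of the two Verma modules with this central character. -/
lemma simple_casimirEigen {M : ModuleCat.{0} U} (hM : InBlock 0 zz M) [IsSimpleModule U M] {i : ℕ}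
    (hc : casimirEigen M (vartheta (-1 + i) zz) = ⊤) :
    Nonempty ((M : Type) ≃ₗ[U] Verma (-1 + (i : ℂ)) zz) ∨
      Nonempty ((M : Type) ≃ₗ[U] Verma (-2 - (i : ℂ)) zz) := by
  have := IsSimpleModule.nontrivial U M
  obtain ⟨n, ⟨e⟩⟩ := exists_equiv_verma hzz M hM
  obtain ⟨x, hx⟩ := exists_ne (0 : M)
  have h1 : e x ∈ casimirEigen _ (vartheta (-1 + i) zz) :=
    map_mem_casimirEigen e.toLinearMap (hc ▸ Submodule.mem_top)
  have h2 : e x ∈ casimirEigen _ (vartheta n zz) :=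
    casimirEigen_verma (n : ℂ) zz ▸ Submodule.mem_top
  have hn : vartheta n zz = vartheta (-1 + i) zz := by
    by_contra h
    exact hx (e.map_eq_zero_iff.1 (eq_zero_of_mem_casimirEigen h h2 h1))
  rcases (vartheta_eq_iff hzz n i).1 hn with h | h
  · have h' : (n : ℂ) = -1 + i := by exact_mod_cast h
    exact Or.inl (h' ▸ ⟨e⟩)
  · have h' : (n : ℂ) = -2 - i := by rw [h]; push_cast; rfl
    exact Or.inr (h' ▸ ⟨e⟩)

/-- A Serre class in the integral block which contains `Δ(-1 + i)` and `Δ(-2 - i)` contains all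
modules of the block with the same central character. -/
lemma SerreClassIn.of_casimirEigen {Pc : ModuleCat.{0} U → Prop}
    (hPc : SerreClassIn (InBlock 0 zz) Pc) {i : ℕ} (hl : Pc (VermaC (-1 + (i : ℂ)) zz))
    (hr : Pc (VermaC (-2 - (i : ℂ)) zz)) {M : ModuleCat.{0} U} (hM : InBlock 0 zz M)
    (hc : casimirEigen M (vartheta (-1 + i) zz) = ⊤) : Pc M := by
  obtain ⟨-, hiso, hses⟩ := hPc
  have hserre := serreClassIn_casimirEigen hzz (vartheta (-1 + i) zz)
  have hlen : IsFiniteLength U M := by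
    have := block_isSemisimple hzz M hM
    have := hM.1.1
    exact (IsSemisimpleModule.finite_tfae.out 0 3).1 this
  suffices ∀ (M : Type) [AddCommGroup M] [Module U M], IsFiniteLength U M →
      InBlock 0 zz (ModuleCat.of U M) → casimirEigen M (vartheta (-1 + i) zz) = ⊤ →
      Pc (ModuleCat.of U M) from this M hlen hM hc
  intro M _ _ hlen
  induction hlen with
  | @of_subsingleton M _ _ _ =>
    intro hM _
    have hbot := ((hses _ (⊥ : Submodule U (Verma (-1 + (i : ℂ)) zz))
      (verma_inBlock_left hzz i)).1 hl).1
    exact hiso _ _ ⟨(LinearEquiv.ofSubsingleton _ _ :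
      (⊥ : Submodule U (Verma (-1 + (i : ℂ)) zz)) ≃ₗ[U] M)⟩ hbot hM
  | @of_simple_quotient M _ _ N _ _ ih =>
    intro hM hc
    obtain ⟨⟨hN, hNc⟩, hQ, hQc⟩ := (hserre.2.2 (ModuleCat.of U M) N hM).1 ⟨hM, hc⟩
    refine (hses (ModuleCat.of U M) N hM).2 ⟨ih hN hNc, ?_⟩
    have : IsSimpleModule U (ModuleCat.of U (M ⧸ N)) := ‹IsSimpleModule U (M ⧸ N)›
    rcases simple_casimirEigen hzz hQ hQc with e | e
    · exact hiso _ _ (e.map LinearEquiv.symm) hl hQ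
    · exact hiso _ _ (e.map LinearEquiv.symm) hr hQ

/-- The subcategory `O[ξ]_{λ_i}` consists of the modules of the block on which the Casimir element
acts by the scalar of `Δ(λ_i)`. -/
lemma intBlockSub_iff {i : ℕ} {M : ModuleCat.{0} U} : intBlockSub zz i M ↔
    InBlock 0 zz M ∧ casimirEigen M (vartheta (-1 + i) zz) = ⊤ := by
  constructor
  · intro h
    refine h.2 _ (serreClassIn_casimirEigen hzz _) ?_
    rintro X (rfl | rfl)
    · exact ⟨verma_inBlock_left hzz i, casimirEigen_verma _ zz⟩
    · exact ⟨verma_inBlock_right hzz i, vartheta_reflect (i : ℂ) zz ▸ casimirEigen_verma _ zz⟩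
  · rintro ⟨hM, hc⟩
    exact ⟨hM, fun Pc hPc hS => hPc.of_casimirEigen hzz (hS _ (by simp)) (hS _ (by simp)) hM hc⟩

/-- A module of the integral block is the direct sum of its Casimir eigenspaces. -/
lemma isInternal_casimirEigen {M : ModuleCat.{0} U} (hM : InBlock 0 zz M) :
    DirectSum.IsInternal fun i : ℕ => casimirEigen M (vartheta (-1 + i) zz) := by
  rw [DirectSum.isInternal_submodule_iff_iSupIndep_and_iSup_eq_top]
  constructor
  · let := cmod M
    have := isScalarTower_cmod M
    have hind := (Module.End.eigenspaces_iSupIndep (Algebra.lsmul ℂ ℂ M cElt)).comp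
      (vartheta_injective hzz)
    have heq : (Module.End.eigenspace (Algebra.lsmul ℂ ℂ (M : Type) cElt) ∘
        fun i : ℕ => vartheta (-1 + i) zz) =
        fun i : ℕ => (casimirEigen M (vartheta (-1 + i) zz)).restrictScalars ℂ := by
      ext i x
      simp [mem_casimirEigen, sc_smul]
    rw [heq] at hind
    intro i
    have := hind i
    rw [Submodule.disjoint_def] at *
    intro x hx hx'
    refine this x hx ?_
    simpa only [← Submodule.restrictScalars_iSup, Submodule.restrictScalars_mem] using hx'
  · rw [← top_le_iff, ← span_singular_eq_top hzz M hM, Submodule.span_le]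
    rintro v ⟨n, hv⟩
    obtain ⟨i, hi⟩ := exists_vartheta_eq hzz n
    exact Submodule.mem_iSup_of_mem i (hi ▸ hv.mem_casimirEigen)

lemma not_nonempty_verma_equiv (i : ℕ) :
    ¬ Nonempty ((Verma (-1 + (i : ℂ)) zz) ≃ₗ[U] Verma (-2 - (i : ℂ)) zz) := by
  rintro ⟨e⟩
  have hcast : ((-1 + i : ℤ) : ℂ) = -1 + i := by push_cast; rfl
  have hsimple : IsSimpleModule U (Verma (-1 + (i : ℂ)) zz) := hcast ▸ verma_isSimple hzz (-1 + i)
  have hne : hwVec (-1 + (i : ℂ)) zz ≠ 0 := fun h => by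
    have := IsSimpleModule.nontrivial U (Verma (-1 + (i : ℂ)) zz)
    obtain ⟨x, hx⟩ := exists_ne (0 : Verma (-1 + (i : ℂ)) zz)
    obtain ⟨u, rfl⟩ := Submodule.Quotient.mk_surjective _ x
    exact hx (by rw [mk_eq_smul_hwVec, h, smul_zero])
  obtain ⟨-, a, b, hab⟩ := verma_weight hzz (mt e.map_eq_zero_iff.1 hne)
    ((hwVec_isSingular _ zz).1.map e.toLinearMap)
  have : ((-1 + i : ℤ) : ℂ) = ((-2 - i - 2 * a - b : ℤ) : ℂ) := by push_cast; exact hab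
  have : (-1 + i : ℤ) = -2 - i - 2 * a - b := by exact_mod_cast this
  omega

end CentralCharacter

/-- Proposition 5 of the paper: let `ξ ∈ 𝔥*/ℤR` have nonzero
central charge `zz` and integral weights (`λ(h) ∈ ℤ` for `λ ∈ ξ`).  Then every
Verma module `Δ(λ)`, `λ ∈ ξ`, is simple; each Serre subcategory `O[ξ]_{λ_i}`
generated by `Δ(λ_i)` and `Δ(r·λ_i)` (where `λ_i(h) = -1 + i`) is equivalent to
the category of finite dimensional `ℂ ⊕ ℂ`-modules, i.e. it is semisimple with
exactly two isomorphism classes of simple objects, represented by `Δ(λ_i)` and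
`Δ(r·λ_i)`; and `O[ξ]` is the direct sum of the subcategories `O[ξ]_{λ_i}`,
`i ∈ ℤ≥0`. -/
theorem integral_block_nonzero_charge (zz : ℂ) (hzz : zz ≠ 0) :
    (∀ n : ℤ, IsSimpleModule U (Verma (n : ℂ) zz)) ∧
    (∀ i : ℕ,
      intBlockSub zz i (VermaC (-1 + (i : ℂ)) zz) ∧
      intBlockSub zz i (VermaC (-2 - (i : ℂ)) zz) ∧
      (∀ M : ModuleCat.{0} U, intBlockSub zz i M → IsSemisimpleModule U M) ∧
      (∀ M : ModuleCat.{0} U, intBlockSub zz i M → IsSimpleModule U M →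
        Nonempty ((M : Type) ≃ₗ[U] Verma (-1 + (i : ℂ)) zz) ∨
        Nonempty ((M : Type) ≃ₗ[U] Verma (-2 - (i : ℂ)) zz)) ∧
      ¬ Nonempty ((Verma (-1 + (i : ℂ)) zz) ≃ₗ[U] Verma (-2 - (i : ℂ)) zz)) ∧
    (∀ M : ModuleCat.{0} U, InBlock 0 zz M →
      ∃ Nn : ℕ → Submodule U M, DirectSum.IsInternal Nn ∧
        ∀ i : ℕ, intBlockSub zz i (ModuleCat.of U (Nn i))) ∧
    (∀ i j : ℕ, i ≠ j → ∀ X Y : ModuleCat.{0} U,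
      intBlockSub zz i X → intBlockSub zz j Y → ∀ f : X →ₗ[U] Y, f = 0) := by
  refine ⟨verma_isSimple hzz, fun i => ⟨?_, ?_, ?_, ?_, not_nonempty_verma_equiv hzz i⟩, ?_, ?_⟩
  · exact (intBlockSub_iff hzz).2 ⟨verma_inBlock_left hzz i, casimirEigen_verma _ zz⟩
  · exact (intBlockSub_iff hzz).2
      ⟨verma_inBlock_right hzz i, vartheta_reflect (i : ℂ) zz ▸ casimirEigen_verma _ zz⟩
  · exact fun M hM => block_isSemisimple hzz M hM.1
  · exact fun M hM _ => simple_casimirEigen hzz hM.1 ((intBlockSub_iff hzz).1 hM).2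
  · exact fun M hM => ⟨_, isInternal_casimirEigen hzz hM, fun i => (intBlockSub_iff hzz).2
      ⟨hM.submodule hzz _, top_le_iff.1 fun x _ => Subtype.ext x.2⟩⟩
  · intro i j hij X Y hX hY f
    refine LinearMap.ext fun x => eq_zero_of_mem_casimirEigen
      ((vartheta_injective hzz).ne hij) (map_mem_casimirEigen f ?_) ?_
    · exact ((intBlockSub_iff hzz).1 hX).2 ▸ Submodule.mem_top
    · exact ((intBlockSub_iff hzz).1 hY).2 ▸ Submodule.mem_top

end

end Schrodinger
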